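/- Let λ ≥ 0 and ε > 0. Assume L̄ is differentiable on (λ, λ+ε) and sup{L̄'(t) : t ∈ (λ, λ+ε)} is not attained; if λ = 0 and L̄'_r(0⁺) = −∞, assume further that L̄ is right continuous at zero. Let z ∈ [L̄'_r(λ⁺), L̄'_l(λ+ε)), let t_z ∈ [λ, λ+ε) satisfy L̄'_r(t_z⁺) = z, and set t̃_z := sup{t > t_z : L̄ is affine on (t_z, t]}. If there exists a sequence (t_{z,i}) in (t̃_z, +∞) converging to t̃_z such that for each i the limit L(t_{z,i}) = lim_α c_α·log ∫_ℝ exp(t_{z,i}·x/c_α) dμ_α(x) exists, then for every net (x_{α,z}) in [-∞,+∞] converging to z and every net (y_{α,z}) with liminf_α y_{α,z} > z, the nets (c_α·log μ_α([x_{α,z}, y_{α,z}])) and (c_α·log μ_α((x_{α,z}, y_{α,z}))) converge to L̄(t_z⁺) − t_z·z. -/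

import Mathlib

open Filter MeasureTheory Set Topology

noncomputable section

/-- `c · log m` as an extended real number, where `m ∈ [0,∞]`. -/
def elog (c : ℝ) (m : ENNReal) : EReal := (c : EReal) * ENNReal.log m

/-- The generalized log-moment generating function `L̄` associated with the net
`(μ_α, c_α)` indexed by the filter `lf`:
`L̄(t) = limsup_α c_α · log ∫ exp(t·x/c_α) dμ_α(x)`. -/
def genLogMGF {ι : Type*} (lf : Filter ι) (μ : ι → Measure ℝ) (c : ι → ℝ) (t : ℝ) : EReal :=
  Filter.limsup
    (fun i => elog (c i) (∫⁻ x : ℝ, ENNReal.ofReal (Real.exp (t * x / c i)) ∂ (μ i))) lf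

/-- Legendre–Fenchel transform of an `EReal`-valued function on `ℝ`, evaluated at an
extended real argument: `L*(x) = sup_t (t·x − L(t))`. -/
def LegendreEE (L : ℝ → EReal) (x : EReal) : EReal := ⨆ t : ℝ, ((t : EReal) * x - L t)

open Classical in
/-- The right derivative of a convex `EReal`-valued function at `t`, with the conventions
`L'_r(t) = +∞` when `L(s) = +∞` for all `s > t` and `L'_r(t) = -∞` when `L(s) = -∞` for
some `s > t`; otherwise it is the infimum of the right difference quotients. -/
def rightDerivE (L : ℝ → EReal) (t : ℝ) : EReal :=
  if ∀ s : ℝ, t < s → L s = ⊤ then ⊤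
  else if ∃ s : ℝ, t < s ∧ L s = ⊥ then ⊥
  else ⨅ s ∈ Set.Ioi t, (L s - L t) * (((s - t)⁻¹ : ℝ) : EReal)

/-- The left derivative of a convex `EReal`-valued function at `t` (supremum of left
difference quotients). -/
def leftDerivE (L : ℝ → EReal) (t : ℝ) : EReal :=
  ⨆ s ∈ Set.Iio t, (L t - L s) * (((t - s)⁻¹ : ℝ) : EReal)

/-- Right limit at `a` of an `EReal`-valued function (as a `limsup`; it coincides with
`lim_{t→a⁺} f(t)` whenever the latter exists, e.g. for monotone or convex `f`). -/
def rightLimE (f : ℝ → EReal) (a : ℝ) : EReal := Filter.limsup f (nhdsWithin a (Set.Ioi a))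

/-- Left limit at `a` of an `EReal`-valued function (as a `limsup`; it coincides with
`lim_{t→a⁻} f(t)` whenever the latter exists). -/
def leftLimE (f : ℝ → EReal) (a : ℝ) : EReal := Filter.limsup f (nhdsWithin a (Set.Iio a))

/-- `L` is affine on the interval `(a, b]`. -/
def AffineOnIoc (L : ℝ → EReal) (a b : ℝ) : Prop :=
  ∃ p q : ℝ, ∀ s ∈ Set.Ioc a b, L s = ((p * s + q : ℝ) : EReal)

/-- `λ̃ = sup {t > λ : L is affine on (λ, t]}` (equal to `λ` if there is no such `t`). -/
def tildeOf (L : ℝ → EReal) (lam : ℝ) : ℝ :=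
  sSup (insert lam {t : ℝ | lam < t ∧ AffineOnIoc L lam t})

/-- Differentiability at `t` of an `EReal`-valued function: `L(t)` is finite and the
difference quotients converge to a (finite) real number. -/
def EDifferentiableAt (L : ℝ → EReal) (t : ℝ) : Prop :=
  (∃ r : ℝ, L t = (r : EReal)) ∧
  ∃ d : ℝ, Filter.Tendsto (fun s => (L s - L t) * (((s - t)⁻¹ : ℝ) : EReal))
    (nhdsWithin t {t}ᶜ) (nhds (d : EReal))

/-- The function `l₀(x) = − lim_{ε→0⁺} limsup_α c_α · log μ_α((x−ε, x+ε))` (the limit over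
`ε` exists by monotonicity and equals the infimum). -/
def l0fun {ι : Type*} (lf : Filter ι) (μ : ι → Measure ℝ) (c : ι → ℝ) (x : ℝ) : EReal :=
  - ⨅ ε ∈ Set.Ioi (0:ℝ),
      Filter.limsup (fun i => elog (c i) (μ i (Set.Ioo (x - ε) (x + ε)))) lf

/-- `L` restricted to `[0,∞)` is proper: `(−∞,+∞]`-valued with at least one finite value. -/
def LbarProper (L : ℝ → EReal) : Prop :=
  (∀ t : ℝ, 0 ≤ t → L t ≠ ⊥) ∧ ∃ t : ℝ, 0 ≤ t ∧ L t ≠ ⊤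

/-- `μ([x, y])` for extended-real endpoints `x, y`, with `μ` regarded as a measure on
`[-∞, +∞]`. -/
def muIccE (μ : Measure ℝ) (x y : EReal) : ENNReal :=
  μ {z : ℝ | x ≤ (z : EReal) ∧ (z : EReal) ≤ y}

/-- `μ((x, y))` for extended-real endpoints `x, y`. -/
def muIooE (μ : Measure ℝ) (x y : EReal) : ENNReal :=
  μ {z : ℝ | x < (z : EReal) ∧ (z : EReal) < y}

open Classical in
/-- The Legendre transform extended to `[-∞,+∞]` by continuity, with the paper's
convention `L̄*(−∞) = −L̄(0⁺)`. -/
def LegendreExt (L : ℝ → EReal) (x : EReal) : EReal :=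
  if x = ⊥ then -(rightLimE L 0) else if x = ⊤ then ⊤ else LegendreEE L x

end

theorem elog_le_coe_iff {c : ℝ} (hc : 0 < c) (m : ENNReal) (A : ℝ) :
    elog c m ≤ (A : EReal) ↔ m ≤ ENNReal.ofReal (Real.exp (A / c)) := by
  have h1 : elog c m ≤ (A : EReal) ↔ ENNReal.log m ≤ ((A / c : ℝ) : EReal) := by
    rw [elog, mul_comm, ← EReal.le_div_iff_mul_le (by exact_mod_cast hc) (EReal.coe_ne_top c),
      ← EReal.coe_div]
  rw [h1, ← EReal.exp_le_exp_iff, ENNReal.exp_log, EReal.exp_coe]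

theorem coe_lt_elog_iff {c : ℝ} (hc : 0 < c) (m : ENNReal) (A : ℝ) :
    (A : EReal) < elog c m ↔ ENNReal.ofReal (Real.exp (A / c)) < m := by
  simpa only [not_le] using (elog_le_coe_iff hc m A).not

theorem elog_mono {c : ℝ} (hc : 0 < c) {m m' : ENNReal} (h : m ≤ m') : elog c m ≤ elog c m' :=
  mul_le_mul_of_nonneg_left (ENNReal.log_monotone h) (by exact_mod_cast hc.le)

/-- The exponential integral `∫ exp(t·x/c) dμ(x)`. -/
noncomputable abbrev expIntegral (μ : Measure ℝ) (c t : ℝ) : ENNReal :=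
  ∫⁻ x : ℝ, ENNReal.ofReal (Real.exp (t * x / c)) ∂μ

theorem expIntegral_convex_combination_le (μ : Measure ℝ) (c : ℝ) {s t a b : ℝ} (ha : 0 ≤ a)
    (hb : 0 ≤ b) (hab : a + b = 1) :
    expIntegral μ c (a * s + b * t) ≤ expIntegral μ c s ^ a * expIntegral μ c t ^ b := by
  refine le_of_eq_of_le (lintegral_congr fun x => ?_)
    (ENNReal.lintegral_mul_norm_pow_le (by fun_prop) (by fun_prop) ha hb hab)
  rw [ENNReal.ofReal_rpow_of_pos (Real.exp_pos _), ENNReal.ofReal_rpow_of_pos (Real.exp_pos _),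
    ← ENNReal.ofReal_mul (by positivity), ← Real.exp_mul, ← Real.exp_mul, ← Real.exp_add]
  congr 2
  ring

theorem elog_expIntegral_convex (μ : Measure ℝ) {c : ℝ} (hc : 0 < c) {s t a b A B : ℝ}
    (ha : 0 ≤ a) (hb : 0 ≤ b) (hab : a + b = 1) (hs : elog c (expIntegral μ c s) ≤ (A : EReal))
    (ht : elog c (expIntegral μ c t) ≤ (B : EReal)) :
    elog c (expIntegral μ c (a * s + b * t)) ≤ ((a * A + b * B : ℝ) : EReal) := by
  rw [elog_le_coe_iff hc] at hs ht ⊢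
  refine (expIntegral_convex_combination_le μ c ha hb hab).trans
    ((mul_le_mul' (ENNReal.rpow_le_rpow hs ha) (ENNReal.rpow_le_rpow ht hb)).trans_eq ?_)
  rw [ENNReal.ofReal_rpow_of_pos (Real.exp_pos _), ENNReal.ofReal_rpow_of_pos (Real.exp_pos _),
    ← ENNReal.ofReal_mul (by positivity), ← Real.exp_mul, ← Real.exp_mul, ← Real.exp_add]
  congr 2
  ring

theorem ereal_le_coe_of_forall_pos_le_add {x : EReal} {A : ℝ}
    (h : ∀ η : ℝ, 0 < η → x ≤ ((A + η : ℝ) : EReal)) : x ≤ (A : EReal) := by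
  refine EReal.le_of_forall_lt_iff_le.1 fun B hB => ?_
  have hB' : A < B := by exact_mod_cast hB
  simpa using h (B - A) (by linarith)

theorem genLogMGF_convex {ι : Type*} (lf : Filter ι) (μ : ι → Measure ℝ) (c : ι → ℝ)
    (hc : ∀ i, 0 < c i) {s t a b A B : ℝ} (ha : 0 ≤ a) (hb : 0 ≤ b) (hab : a + b = 1)
    (hs : genLogMGF lf μ c s ≤ (A : EReal)) (ht : genLogMGF lf μ c t ≤ (B : EReal)) :
    genLogMGF lf μ c (a * s + b * t) ≤ ((a * A + b * B : ℝ) : EReal) := by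
  refine ereal_le_coe_of_forall_pos_le_add fun η hη => ?_
  have hs' : genLogMGF lf μ c s < ((A + η : ℝ) : EReal) :=
    hs.trans_lt (by exact_mod_cast lt_add_of_pos_right A hη)
  have ht' : genLogMGF lf μ c t < ((B + η : ℝ) : EReal) :=
    ht.trans_lt (by exact_mod_cast lt_add_of_pos_right B hη)
  refine limsup_le_of_le (h := ?_)
  filter_upwards [eventually_lt_of_limsup_lt hs', eventually_lt_of_limsup_lt ht'] with i h1 h2
  have := elog_expIntegral_convex (μ i) (hc i) ha hb hab h1.le h2.le
  rwa [show a * (A + η) + b * (B + η) = a * A + b * B + η by linear_combination η * hab] at this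

theorem setLIntegral_exp_le (μ : Measure ℝ) {c : ℝ} (hc : 0 < c) {S : Set ℝ}
    (hS : MeasurableSet S) {s t k : ℝ} (h : ∀ x ∈ S, s * x ≤ t * x + k) :
    ∫⁻ x in S, ENNReal.ofReal (Real.exp (s * x / c)) ∂μ ≤
      ENNReal.ofReal (Real.exp (k / c)) *
        ∫⁻ x in S, ENNReal.ofReal (Real.exp (t * x / c)) ∂μ := by
  rw [← lintegral_const_mul _ (by fun_prop)]
  refine setLIntegral_mono' hS fun x hx => ?_
  rw [← ENNReal.ofReal_mul (by positivity), ← Real.exp_add, ← add_div]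
  gcongr
  linarith [h x hx]

theorem measure_Ici_le_exp_mul (μ : Measure ℝ) {c : ℝ} (hc : 0 < c) {t : ℝ} (ht : 0 ≤ t) (w : ℝ) :
    μ (Ici w) ≤ ENNReal.ofReal (Real.exp (-(t * w) / c)) * expIntegral μ c t := by
  have h := setLIntegral_exp_le μ hc (measurableSet_Ici (a := w)) (s := 0) (t := t) (k := -(t * w))
    fun x hx => by nlinarith [mem_Ici.1 hx]
  simp only [zero_mul, zero_div, Real.exp_zero, ENNReal.ofReal_one, lintegral_const, one_mul,
    Measure.restrict_apply MeasurableSet.univ, univ_inter] at h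
  exact h.trans (by gcongr; exact setLIntegral_le_lintegral _ _)

/-- Splitting an exponential integral at the endpoints of an interval, with an exponential change
of parameter on both tails. -/
theorem expIntegral_le_add_tails (μ : Measure ℝ) {c : ℝ} (hc : 0 < c) {t h p q : ℝ} (ht : 0 ≤ t)
    (hh : 0 ≤ h) :
    expIntegral μ c t ≤
      ENNReal.ofReal (Real.exp (h * p / c)) * expIntegral μ c (t - h) +
      ENNReal.ofReal (Real.exp (-(h * q) / c)) * expIntegral μ c (t + h) +
      ENNReal.ofReal (Real.exp (t * q / c)) * μ (Ioo p q) := by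
  have hcover : (univ : Set ℝ) ⊆ (Iic p ∪ Ici q) ∪ Ioo p q := fun x _ => by
    simp only [mem_union, mem_Iic, mem_Ici, mem_Ioo]
    by_cases h1 : x ≤ p
    · exact .inl (.inl h1)
    by_cases h2 : q ≤ x
    · exact .inl (.inr h2)
    exact .inr ⟨not_le.1 h1, not_le.1 h2⟩
  have h1 := setLIntegral_exp_le μ hc (measurableSet_Iic (a := p)) (s := t) (t := t - h)
    (k := h * p) fun x hx => by nlinarith [mem_Iic.1 hx]
  have h2 := setLIntegral_exp_le μ hc (measurableSet_Ici (a := q)) (s := t) (t := t + h)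
    (k := -(h * q)) fun x hx => by nlinarith [mem_Ici.1 hx]
  have h3 := setLIntegral_exp_le μ hc (measurableSet_Ioo (a := p) (b := q)) (s := t) (t := 0)
    (k := t * q) fun x hx => by nlinarith [hx.2]
  simp only [zero_mul, zero_div, Real.exp_zero, ENNReal.ofReal_one, lintegral_const, one_mul,
    Measure.restrict_apply MeasurableSet.univ, univ_inter] at h3
  calc expIntegral μ c t
      ≤ ∫⁻ x in (Iic p ∪ Ici q) ∪ Ioo p q, ENNReal.ofReal (Real.exp (t * x / c)) ∂μ := by
        rw [expIntegral, ← setLIntegral_univ]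
        exact lintegral_mono_set hcover
    _ ≤ _ := (lintegral_union_le _ _ _).trans
        (add_le_add ((lintegral_union_le _ _ _).trans (add_le_add
          (h1.trans (by gcongr; exact setLIntegral_le_lintegral _ _))
          (h2.trans (by gcongr; exact setLIntegral_le_lintegral _ _)))) h3)

/-- Local large deviation lower bound at the derivative `v` of the limiting log-moment generating
function at a point `t` where the limit exists. -/
theorem eventually_exp_le_measure_Ioo {ι : Type*} (lf : Filter ι) (μ : ι → Measure ℝ)
    [∀ i, IsProbabilityMeasure (μ i)] (c : ι → ℝ) (hc : ∀ i, 0 < c i)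
    (hc0 : Tendsto c lf (𝓝 0)) (g : ℝ → ℝ) {t v δ η : ℝ} (ht : 0 ≤ t) (hδ : 0 < δ) (hη : 0 < η)
    (hg : ∀ᶠ s in 𝓝 t, genLogMGF lf μ c s ≤ (g s : EReal)) (hd : HasDerivAt g v t)
    (hlim : Tendsto (fun i => elog (c i) (expIntegral (μ i) (c i) t)) lf (𝓝 (g t : EReal))) :
    ∀ᶠ i in lf, ((g t - t * (v + δ) - η : ℝ) : EReal) ≤
      elog (c i) (μ i (Ioo (v - δ) (v + δ))) := by
  obtain ⟨h, hh, hgp, hgm, hLp, hLm⟩ : ∃ h : ℝ, 0 < h ∧ g (t + h) - h * (v + δ) < g t ∧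
      g (t - h) + h * (v - δ) < g t ∧ genLogMGF lf μ c (t + h) ≤ (g (t + h) : EReal) ∧
      genLogMGF lf μ c (t - h) ≤ (g (t - h) : EReal) := by
    have h1 : ∀ᶠ s in 𝓝 t, |g s - g t - (s - t) * v| ≤ δ / 2 * |s - t| := by
      simpa using hd.isLittleO.def (half_pos hδ)
    obtain ⟨r, hr, hball⟩ := Metric.eventually_nhds_iff.1 (h1.and hg)
    have hp := hball (y := t + r / 2) (by simp [abs_of_pos hr]; linarith)
    have hm := hball (y := t - r / 2) (by simp [abs_of_pos hr]; linarith)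
    have hδr : 0 < δ * r := mul_pos hδ hr
    refine ⟨r / 2, half_pos hr, ?_, ?_, hp.2, hm.2⟩
    · have := (abs_le.1 hp.1).2
      rw [show t + r / 2 - t = r / 2 by ring, abs_of_pos (half_pos hr)] at this
      nlinarith
    · have := (abs_le.1 hm.1).2
      rw [show t - r / 2 - t = -(r / 2) by ring, abs_neg, abs_of_pos (half_pos hr)] at this
      nlinarith
  obtain ⟨κ, hκ, hκη, hκp, hκm⟩ : ∃ κ : ℝ, 0 < κ ∧ 2 * κ ≤ η ∧
      g (t + h) - h * (v + δ) + 3 * κ ≤ g t ∧ g (t - h) + h * (v - δ) + 3 * κ ≤ g t := by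
    refine ⟨min (η / 2) (min ((g t - (g (t + h) - h * (v + δ))) / 3)
      ((g t - (g (t - h) + h * (v - δ))) / 3)), ?_, ?_, ?_, ?_⟩
    · refine lt_min (by linarith) (lt_min (by linarith) (by linarith))
    · linarith [min_le_left (η / 2) (min ((g t - (g (t + h) - h * (v + δ))) / 3)
        ((g t - (g (t - h) + h * (v - δ))) / 3))]
    · have := (min_le_right (η / 2) _).trans (min_le_left ((g t - (g (t + h) - h * (v + δ))) / 3)
        ((g t - (g (t - h) + h * (v - δ))) / 3))
      linarith
    · have := (min_le_right (η / 2) _).trans (min_le_right ((g t - (g (t + h) - h * (v + δ))) / 3)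
        ((g t - (g (t - h) + h * (v - δ))) / 3))
      linarith
  have e1 := hlim.eventually_const_lt (u := ((g t - κ : ℝ) : EReal))
    (by exact_mod_cast sub_lt_self _ hκ)
  have e2 := eventually_lt_of_limsup_lt (hLp.trans_lt
    (show (g (t + h) : EReal) < ((g (t + h) + κ : ℝ) : EReal) by
      exact_mod_cast lt_add_of_pos_right _ hκ))
  have e3 := eventually_lt_of_limsup_lt (hLm.trans_lt
    (show (g (t - h) : EReal) < ((g (t - h) + κ : ℝ) : EReal) by
      exact_mod_cast lt_add_of_pos_right _ hκ))
  have e4 : ∀ᶠ i in lf, c i < κ / 4 := hc0.eventually_lt_const (by linarith)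
  filter_upwards [e1, e2, e3, e4] with i h1 h2 h3 h4
  have hci := hc i
  rw [coe_lt_elog_iff hci] at h1
  replace h2 := (elog_le_coe_iff hci _ _).1 h2.le
  replace h3 := (elog_le_coe_iff hci _ _).1 h3.le
  have hexp : 4 < Real.exp (κ / c i) := by
    have : 4 < κ / c i := by rw [lt_div_iff₀ hci]; linarith
    linarith [Real.add_one_le_exp (κ / c i)]
  set M := (μ i (Ioo (v - δ) (v + δ))).toReal with hM
  have hMeq : μ i (Ioo (v - δ) (v + δ)) = ENNReal.ofReal M :=
    (ENNReal.ofReal_toReal (measure_ne_top _ _)).symm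
  have hM0 : 0 ≤ M := ENNReal.toReal_nonneg
  have key := h1.le.trans (expIntegral_le_add_tails (μ i) hci (p := v - δ) (q := v + δ) ht hh.le)
  have bound : ∀ {k s A : ℝ}, expIntegral (μ i) (c i) s ≤ ENNReal.ofReal (Real.exp (A / c i)) →
      k + A ≤ g t - 2 * κ → ENNReal.ofReal (Real.exp (k / c i)) * expIntegral (μ i) (c i) s ≤
        ENNReal.ofReal (Real.exp ((g t - 2 * κ) / c i)) := by
    intro k s A hA hk
    refine (mul_le_mul_right hA _).trans ?_
    rw [← ENNReal.ofReal_mul (by positivity), ← Real.exp_add, ← add_div]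
    gcongr
  replace key := key.trans (add_le_add_left (add_le_add
    (bound h3 (by linarith)) (bound h2 (by linarith))) _)
  rw [hMeq, ← ENNReal.ofReal_add (by positivity) (by positivity),
    ← ENNReal.ofReal_mul (by positivity), ← ENNReal.ofReal_add (by positivity) (by positivity),
    ENNReal.ofReal_le_ofReal_iff (by positivity)] at key
  refine le_of_not_gt fun hlt => ?_
  have hlt' := (elog_le_coe_iff hci _ _).1 hlt.le
  rw [hMeq, ENNReal.ofReal_le_ofReal_iff (by positivity)] at hlt'
  have hmul : Real.exp (t * (v + δ) / c i) * M ≤ Real.exp ((g t - 2 * κ) / c i) := by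
    refine (mul_le_mul_of_nonneg_left hlt' (by positivity)).trans ?_
    rw [← Real.exp_add, ← add_div]
    gcongr
    linarith
  have hsplit : Real.exp ((g t - κ) / c i) =
      Real.exp (κ / c i) * Real.exp ((g t - 2 * κ) / c i) := by
    rw [← Real.exp_add, ← add_div]
    ring_nf
  have := Real.exp_pos ((g t - 2 * κ) / c i)
  nlinarith

/-- Convexity of an `EReal`-valued function, phrased through real upper bounds so that no
undefined sums of infinities occur. -/
def EConvex (L : ℝ → EReal) : Prop :=
  ∀ ⦃s t a b A B : ℝ⦄, 0 ≤ a → 0 ≤ b → a + b = 1 → L s ≤ (A : EReal) → L t ≤ (B : EReal) →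
    L (a * s + b * t) ≤ ((a * A + b * B : ℝ) : EReal)

theorem EConvex.eq_bot_of_mem_openSegment {L : ℝ → EReal} (hL : EConvex L) {s t w : ℝ}
    (hs : L s = ⊥) (ht : L t ≠ ⊤) (hw : w ∈ openSegment ℝ s t) : L w = ⊥ := by
  obtain ⟨a, b, ha, hb, hab, rfl⟩ := hw
  refine (EReal.eq_bot_iff_forall_lt _).2 fun y => ?_
  have h := hL ha.le hb.le hab (A := (y - 1 - b * (L t).toReal) / a) (hs ▸ bot_le)
    (EReal.le_coe_toReal ht)
  rw [mul_div_cancel₀ _ ha.ne'] at h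
  refine h.trans_lt ?_
  exact_mod_cast (by linarith : y - 1 - b * (L t).toReal + b * (L t).toReal < y)

theorem EConvex.ne_bot {L : ℝ → EReal} (hL : EConvex L) {lo hi : ℝ} (hlt : lo < hi)
    (hfin : ∀ t ∈ Ioo lo hi, ∃ r : ℝ, L t = (r : EReal)) (t : ℝ) : L t ≠ ⊥ := by
  intro hbot
  obtain ⟨p, hp⟩ := exists_between hlt
  obtain ⟨q, hq⟩ := exists_between hp.1
  obtain ⟨r, hr⟩ := exists_between hp.2
  have hne : ∀ w ∈ Ioo lo hi, L w ≠ ⊤ ∧ L w ≠ ⊥ := fun w hw => by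
    obtain ⟨x, hx⟩ := hfin w hw
    simp [hx]
  rcases lt_trichotomy t p with h | h | h
  · exact (hne p hp).2 (hL.eq_bot_of_mem_openSegment hbot (hne r ⟨hp.1.trans hr.1, hr.2⟩).1
      (by rw [openSegment_eq_Ioo (h.trans hr.1)]; exact ⟨h, hr.1⟩))
  · exact (hne p hp).2 (h ▸ hbot)
  · exact (hne p hp).2 (hL.eq_bot_of_mem_openSegment hbot (hne q ⟨hq.1, hq.2.trans hp.2⟩).1
      (by rw [openSegment_symm, openSegment_eq_Ioo (hq.2.trans h)]; exact ⟨hq.2, h⟩))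

theorem EConvex.convexOn_toReal {L : ℝ → EReal} (hL : EConvex L) (hbot : ∀ t, L t ≠ ⊥) :
    ConvexOn ℝ {t | L t ≠ ⊤} (fun t => (L t).toReal) := by
  have key : ∀ ⦃s⦄, L s ≠ ⊤ → ∀ ⦃t⦄, L t ≠ ⊤ → ∀ ⦃a b : ℝ⦄, 0 ≤ a → 0 ≤ b → a + b = 1 →
      L (a * s + b * t) ≤ ((a * (L s).toReal + b * (L t).toReal : ℝ) : EReal) :=
    fun s hs t ht a b ha hb hab =>
      hL ha hb hab (EReal.le_coe_toReal hs) (EReal.le_coe_toReal ht)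
  refine ⟨fun s hs t ht a b ha hb hab => ?_, fun s hs t ht a b ha hb hab => ?_⟩
  · exact ((key hs ht ha hb hab).trans_lt (EReal.coe_lt_top _)).ne
  · have h := EReal.toReal_le_toReal (key hs ht ha hb hab) (hbot _) (EReal.coe_ne_top _)
    simpa only [EReal.toReal_coe, smul_eq_mul] using h

theorem coe_slope_toReal {L : ℝ → EReal} {s t : ℝ} (hs : ∃ r : ℝ, L s = (r : EReal))
    (ht : ∃ r : ℝ, L t = (r : EReal)) :
    (L s - L t) * (((s - t)⁻¹ : ℝ) : EReal) =
      ((slope (fun u => (L u).toReal) t s : ℝ) : EReal) := by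
  obtain ⟨r, hr⟩ := hs
  obtain ⟨r', hr'⟩ := ht
  rw [slope_def_field, hr, hr', div_eq_mul_inv]
  simp only [EReal.toReal_coe]
  norm_cast

theorem EDifferentiableAt.differentiableAt_toReal {L : ℝ → EReal} {t : ℝ}
    (h : EDifferentiableAt L t) (hfin : ∀ᶠ s in 𝓝 t, ∃ r : ℝ, L s = (r : EReal)) :
    DifferentiableAt ℝ (fun u => (L u).toReal) t := by
  obtain ⟨ht, d, hd⟩ := h
  refine (hasDerivAt_iff_tendsto_slope.2 (EReal.tendsto_coe.1 (hd.congr' ?_)) :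
    HasDerivAt _ d t).differentiableAt
  filter_upwards [hfin.filter_mono nhdsWithin_le_nhds] with s hs
  exact coe_slope_toReal hs ht

theorem EConvex.rightDerivE_eq {L : ℝ → EReal} (hL : EConvex L) (hbot : ∀ t, L t ≠ ⊥) {t : ℝ}
    (hfin : ∀ᶠ s in 𝓝 t, ∃ r : ℝ, L s = (r : EReal))
    (hd : DifferentiableAt ℝ (fun u => (L u).toReal) t) :
    rightDerivE L t = ((deriv (fun u => (L u).toReal) t : ℝ) : EReal) := by
  have ht : ∃ r : ℝ, L t = (r : EReal) := hfin.self_of_nhds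
  have hright : ∀ᶠ s in 𝓝[>] t, ∃ r : ℝ, L s = (r : EReal) := hfin.filter_mono nhdsWithin_le_nhds
  obtain ⟨s₀, hs₀, r₀, hr₀⟩ := (eventually_mem_nhdsWithin.and hright).exists
  rw [rightDerivE, if_neg (fun h => by simpa [hr₀] using h s₀ hs₀),
    if_neg (fun ⟨s, _, h⟩ => hbot s h)]
  refine le_antisymm ?_ (le_iInf₂ fun s hs => ?_)
  · have hlim := (hasDerivAt_iff_tendsto_slope.1 hd.hasDerivAt).mono_left
      (nhdsWithin_mono t fun s (hs : s ∈ Ioi t) => ne_of_gt hs)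
    refine ge_of_tendsto (EReal.tendsto_coe.2 hlim) ?_
    filter_upwards [eventually_mem_nhdsWithin, hright] with s hs hs'
    rw [← coe_slope_toReal hs' ht]
    exact iInf₂_le s hs
  · by_cases htop : L s = ⊤
    · obtain ⟨r, hr⟩ := ht
      rw [htop, hr, EReal.top_sub_coe,
        EReal.top_mul_of_pos (by exact_mod_cast inv_pos.2 (sub_pos.2 hs))]
      exact le_top
    · rw [coe_slope_toReal ⟨_, (EReal.coe_toReal htop (hbot s)).symm⟩ ht]
      obtain ⟨r, hr⟩ := ht
      exact_mod_cast (hL.convexOn_toReal hbot).deriv_le_slope (by simp [hr]) htop hs hd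

section MonotoneConvex

variable {f : ℝ → ℝ} {a b : ℝ}

theorem ConvexOn.add_deriv_mul_le {S : Set ℝ} (hf : ConvexOn ℝ S f) {s t : ℝ} (hs : s ∈ S)
    (ht : t ∈ S) (hd : DifferentiableAt ℝ f s) : f s + deriv f s * (t - s) ≤ f t := by
  rcases lt_trichotomy s t with h | rfl | h
  · have := hf.deriv_le_slope hs ht h hd
    rw [slope_def_field, le_div_iff₀ (sub_pos.2 h)] at this
    linarith
  · simp
  · have := hf.slope_le_deriv ht hs h hd
    rw [slope_def_field, div_le_iff₀ (sub_pos.2 h)] at this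
    linarith

theorem ConvexOn.exists_tendsto_nhdsGT (hab : a < b) (hf : ConvexOn ℝ (Ioo a b) f)
    (hd : ∀ t ∈ Ioo a b, DifferentiableAt ℝ f t) (hnn : ∀ t ∈ Ioo a b, 0 ≤ deriv f t) :
    MonotoneOn f (Ioo a b) ∧
      ∃ m, Tendsto f (𝓝[>] a) (𝓝 m) ∧ ∀ t ∈ Ioo a b, m ≤ f t := by
  have hmono : MonotoneOn f (Ioo a b) := fun s hs t ht hst => by
    nlinarith [hf.add_deriv_mul_le hs ht (hd s hs), hnn s hs]
  obtain ⟨p, hp⟩ := exists_between hab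
  have hbdd : BddBelow (f '' Ioo a b) := by
    refine ⟨f p + deriv f p * (a - p), ?_⟩
    rintro _ ⟨s, hs, rfl⟩
    nlinarith [hf.add_deriv_mul_le hp hs (hd p hp), hnn p hp, hs.1]
  exact ⟨hmono, _, hmono.tendsto_nhdsWithin_Ioo_right ⟨p, hp⟩ hbdd,
    fun t ht => csInf_le hbdd (mem_image_of_mem f ht)⟩

theorem ConvexOn.eventually_deriv_lt_of_isMinOn (hf : ConvexOn ℝ (Ioo a b) f)
    (hd : ∀ t ∈ Ioo a b, DifferentiableAt ℝ f t) {T : ℝ} (hT : T ∈ Ioo a b)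
    (hmin : ∀ t ∈ Ioo a b, f T ≤ f t) {η : ℝ} (hη : 0 < η) :
    ∀ᶠ t in 𝓝[>] T, deriv f t < η := by
  have hmem : Ioo a b ∈ 𝓝 T := isOpen_Ioo.mem_nhds hT
  have hloc : IsLocalMin f T := Filter.mem_of_superset hmem hmin
  have hslope := hasDerivAt_iff_tendsto_slope.1 (hd T hT).hasDerivAt
  rw [hloc.deriv_eq_zero] at hslope
  have hev : ∀ᶠ s in 𝓝[>] T, slope f T s < η :=
    (hslope.mono_left (nhdsWithin_mono T fun s hs => ne_of_gt hs)).eventually_lt_const hη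
  obtain ⟨s, hs, hTs, hsI⟩ := (hev.and (eventually_mem_nhdsWithin.and
    (eventually_mem_set.2 (mem_nhdsWithin_of_mem_nhds hmem)))).exists
  replace hTs : T < s := hTs
  rw [slope_def_field, div_lt_iff₀ (sub_pos.2 hTs)] at hs
  have hcont : ContinuousAt (fun t => f s - f t - η * (s - t)) T :=
    (continuousAt_const.sub (hd T hT).continuousAt).sub (by fun_prop)
  have hneg := hcont.eventually_lt_const (u := 0) (by linarith)
  filter_upwards [hneg.filter_mono nhdsWithin_le_nhds, Ioo_mem_nhdsGT hTs] with t ht htI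
  have htI' : t ∈ Ioo a b := ⟨hT.1.trans htI.1, htI.2.trans hsI.2⟩
  have := hf.add_deriv_mul_le htI' hsI (hd t htI')
  nlinarith [htI.2]

end MonotoneConvex

/-- Behaviour of a convex function to the right of the point `a` and of `tildeOf L a`, after
subtracting the linear function with the limiting slope `z` at `a`. -/
theorem EConvex.tildeOf_spec {L : ℝ → EReal} {g : ℝ → ℝ} {a b z s₀ : ℝ}
    (hg : ConvexOn ℝ (Ioo a b) g) (hLg : ∀ t ∈ Ioo a b, L t = (g t : EReal))
    (hd : ∀ t ∈ Ioo a b, DifferentiableAt ℝ g t)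
    (hD : ∀ t ∈ Ioo a b, rightDerivE L t = ((deriv g t : ℝ) : EReal))
    (hz : rightLimE (rightDerivE L) a = (z : EReal)) (hs₀ : s₀ ∈ Ioo a b)
    (hzs₀ : z < deriv g s₀) :
    ∃ m : ℝ, rightLimE L a = ((m + a * z : ℝ) : EReal) ∧
      (∀ η > 0, ∃ t ∈ Ioo a b, g t - z * t < m + η) ∧
      a ≤ tildeOf L a ∧ tildeOf L a < b ∧
      (∀ t ∈ Ioo (tildeOf L a) b, z < deriv g t ∧ m ≤ g t - z * t) ∧
      ∀ η > 0, ∀ᶠ t in 𝓝[>] (tildeOf L a), deriv g t < z + η := by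
  have hab : a < b := hs₀.1.trans hs₀.2
  set T := tildeOf L a with hT
  set f : ℝ → ℝ := fun t => g t - z * t with hfdef
  have hfconv : ConvexOn ℝ (Ioo a b) f := by
    refine hg.sub ?_
    exact (LinearMap.mulLeft ℝ z).concaveOn (convex_Ioo a b)
  have hfd : ∀ t ∈ Ioo a b, HasDerivAt f (deriv g t - z) t := fun t ht => by
    have h := (hd t ht).hasDerivAt.sub ((hasDerivAt_id t).const_mul z)
    rwa [mul_one] at h
  have hfd' : ∀ t ∈ Ioo a b, DifferentiableAt ℝ f t := fun t ht => (hfd t ht).differentiableAt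
  have hfderiv : ∀ t ∈ Ioo a b, deriv f t = deriv g t - z := fun t ht => (hfd t ht).deriv
  have hgmono : MonotoneOn (deriv g) (Ioo a b) := hg.monotoneOn_deriv hd
  have hlt : ∀ η > 0, ∀ᶠ t in 𝓝[>] a, deriv g t < z + η := fun η hη => by
    have h := eventually_lt_of_limsup_lt (hz.trans_lt
      (show (z : EReal) < ((z + η : ℝ) : EReal) by exact_mod_cast lt_add_of_pos_right z hη))
    filter_upwards [h, Ioo_mem_nhdsGT hab] with t ht htI
    rw [hD t htI] at ht
    exact_mod_cast ht
  have hge : ∀ t ∈ Ioo a b, z ≤ deriv g t := fun t ht => by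
    have : rightLimE (rightDerivE L) a ≤ ((deriv g t : ℝ) : EReal) := by
      refine limsup_le_of_le (h := ?_)
      filter_upwards [Ioo_mem_nhdsGT ht.1] with s hs
      have hs' : s ∈ Ioo a b := ⟨hs.1, hs.2.trans ht.2⟩
      rw [hD s hs']
      exact_mod_cast hgmono hs' ht hs.2.le
    rw [hz] at this
    exact_mod_cast this
  obtain ⟨hfmono, m, hm, hmle⟩ := hfconv.exists_tendsto_nhdsGT hab hfd'
    fun t ht => by rw [hfderiv t ht]; linarith [hge t ht]
  have hexists : ∀ η > 0, ∃ t ∈ Ioo a b, f t < m + η := fun η hη => by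
    obtain ⟨t, h1, h2⟩ := ((hm.eventually_lt_const (lt_add_of_pos_right m hη)).and
      (Ioo_mem_nhdsGT hab)).exists
    exact ⟨t, h2, h1⟩
  have haffine : ∀ t, a < t → AffineOnIoc L a t → ∀ s ∈ Ioc a t, s < b → f s = m := by
    rintro t hat ⟨p, q, hpq⟩
    have hgs : ∀ s ∈ Ioc a t, s < b → g s = p * s + q := fun s hs hsb => by
      have := hpq s hs
      rw [hLg s ⟨hs.1, hsb⟩] at this
      exact_mod_cast this
    have hpder : ∀ s ∈ Ioo a (min t b), deriv g s = p := fun s hs => by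
      have hev : g =ᶠ[𝓝 s] fun u => p * u + q := by
        filter_upwards [isOpen_Ioo.mem_nhds hs] with u hu
        exact hgs u ⟨hu.1, (hu.2.trans_le (min_le_left _ _)).le⟩ (hu.2.trans_le (min_le_right _ _))
      rw [hev.deriv_eq]
      simp
    have hmin : a < min t b := lt_min hat hab
    have hpz : p = z := by
      have hlim : Tendsto (rightDerivE L) (𝓝[>] a) (𝓝 (p : EReal)) := by
        refine tendsto_const_nhds.congr' ?_
        filter_upwards [Ioo_mem_nhdsGT hmin] with s hs
        rw [hD s ⟨hs.1, hs.2.trans_le (min_le_right _ _)⟩, hpder s hs]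
      have : (p : EReal) = z := hlim.limsup_eq.symm.trans hz
      exact_mod_cast this
    have hfq : ∀ s ∈ Ioc a t, s < b → f s = q := fun s hs hsb => by
      simp only [hfdef, hgs s hs hsb, hpz]
      ring
    have hqm : q = m := by
      refine tendsto_nhds_unique (tendsto_const_nhds.congr' ?_) hm
      filter_upwards [Ioo_mem_nhdsGT hmin] with s hs
      exact (hfq s ⟨hs.1, (hs.2.trans_le (min_le_left _ _)).le⟩
        (hs.2.trans_le (min_le_right _ _))).symm
    exact fun s hs hsb => (hfq s hs hsb).trans hqm
  have hbound : ∀ t ∈ insert a {t : ℝ | a < t ∧ AffineOnIoc L a t}, t ≤ s₀ := by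
    rintro t (rfl | ⟨hat, haff⟩)
    · exact hs₀.1.le
    by_contra! hlt'
    obtain ⟨s, hs⟩ := exists_between (lt_min hlt' hs₀.2)
    have hst : s < t := hs.2.trans_le (min_le_left _ _)
    have hsb : s < b := hs.2.trans_le (min_le_right _ _)
    have h1 := haffine t hat haff s ⟨hs₀.1.trans hs.1, hst.le⟩ hsb
    have h2 := haffine t hat haff s₀ ⟨hs₀.1, hlt'.le⟩ hs₀.2
    have h3 := hfconv.add_deriv_mul_le hs₀ ⟨hs₀.1.trans hs.1, hsb⟩ (hfd' s₀ hs₀)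
    rw [hfderiv s₀ hs₀] at h3
    nlinarith [hs.1]
  have hbdd : BddAbove (insert a {t : ℝ | a < t ∧ AffineOnIoc L a t}) := ⟨s₀, hbound⟩
  have haT : a ≤ T := le_csSup hbdd (mem_insert _ _)
  have hTb : T < b := (csSup_le (insert_nonempty _ _) hbound).trans_lt hs₀.2
  refine ⟨m, ?_, hexists, haT, hTb, fun t ht => ?_, fun η hη => ?_⟩
  · refine Tendsto.limsup_eq ?_
    have h1 : Tendsto (fun t => f t + z * t) (𝓝[>] a) (𝓝 (m + a * z)) := by
      rw [mul_comm a z]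
      exact hm.add ((continuous_const.mul continuous_id).continuousAt.tendsto.mono_left
        nhdsWithin_le_nhds)
    refine (EReal.tendsto_coe.2 h1).congr' ?_
    filter_upwards [Ioo_mem_nhdsGT hab] with t ht
    rw [hLg t ht]
    simp [hfdef]
  · have htI : t ∈ Ioo a b := ⟨haT.trans_lt ht.1, ht.2⟩
    refine ⟨?_, hmle t htI⟩
    have hmt : m < f t := by
      refine lt_of_le_of_ne (hmle t htI) fun heq => ht.1.not_ge (le_csSup hbdd (.inr ⟨htI.1, ?_⟩))
      refine ⟨z, m, fun s hs => ?_⟩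
      have hsI : s ∈ Ioo a b := ⟨hs.1, hs.2.trans_lt htI.2⟩
      have : f s = m := le_antisymm (heq ▸ hfmono hsI htI hs.2) (hmle s hsI)
      rw [hLg s hsI, ← this]
      simp [hfdef]
    obtain ⟨s, hsI, hs⟩ := hexists (f t - m) (by linarith)
    have h1 := hfconv.add_deriv_mul_le htI hsI (hfd' t htI)
    rw [hfderiv t htI] at h1
    by_contra! hle
    have heq : deriv g t = z := le_antisymm hle (hge t htI)
    rw [heq] at h1
    linarith
  · rcases haT.eq_or_lt with heq | haT'
    · rw [← heq]
      exact hlt η hη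
    have hTI : T ∈ Ioo a b := ⟨haT', hTb⟩
    have hconst : ∀ s ∈ Ioo a T, f s = m := fun s hs => by
      obtain ⟨t, ht, hst⟩ := exists_lt_of_lt_csSup (insert_nonempty _ _) hs.2
      rcases ht with rfl | ⟨hat, haff⟩
      · exact absurd hs.1 hst.le.not_gt
      · exact haffine t hat haff s ⟨hs.1, hst.le⟩ (hs.2.trans hTb)
    have hfT : f T = m := by
      refine tendsto_nhds_unique
        ((hfd' T hTI).continuousAt.tendsto.mono_left (nhdsWithin_le_nhds (s := Iio T)))
        (tendsto_const_nhds.congr' ?_)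
      filter_upwards [Ioo_mem_nhdsLT haT'] with s hs
      exact (hconst s hs).symm
    filter_upwards [hfconv.eventually_deriv_lt_of_isMinOn hfd' hTI (fun t ht => hfT ▸ hmle t ht) hη,
      Ioo_mem_nhdsGT hTb] with t ht htI
    rw [hfderiv t ⟨haT'.trans htI.1, htI.2⟩] at ht
    linarith

theorem tendsto_coe_ereal_of_forall_pos {ι : Type*} {lf : Filter ι} {u : ι → EReal} {R : ℝ}
    (hlow : ∀ η : ℝ, 0 < η → ∀ᶠ i in lf, ((R - η : ℝ) : EReal) ≤ u i)
    (hup : ∀ η : ℝ, 0 < η → ∀ᶠ i in lf, u i ≤ ((R + η : ℝ) : EReal)) :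
    Tendsto u lf (𝓝 (R : EReal)) := by
  refine tendsto_order.2 ⟨fun y hy => ?_, fun y hy => ?_⟩
  · obtain ⟨r, hyr, hrR⟩ := EReal.lt_iff_exists_real_btwn.1 hy
    have hrR' : r < R := by exact_mod_cast hrR
    filter_upwards [hlow (R - r) (sub_pos.2 hrR')] with i hi
    exact hyr.trans_le (by simpa using hi)
  · obtain ⟨r, hRr, hry⟩ := EReal.lt_iff_exists_real_btwn.1 hy
    have hRr' : R < r := by exact_mod_cast hRr
    filter_upwards [hup (r - R) (sub_pos.2 hRr')] with i hi
    exact (show u i ≤ (r : EReal) by simpa using hi).trans_lt hry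

theorem muIooE_le_muIccE (μ : Measure ℝ) (x y : EReal) : muIooE μ x y ≤ muIccE μ x y :=
  measure_mono fun _ h => ⟨h.1.le, h.2.le⟩

/-- Chernoff upper bound for intervals whose left endpoints converge to `z`. -/
theorem eventually_elog_muIccE_le {ι : Type*} (lf : Filter ι) (μ : ι → Measure ℝ) (c : ι → ℝ)
    (hc : ∀ i, 0 < c i) {t z B : ℝ} (ht : 0 ≤ t) (hB : genLogMGF lf μ c t ≤ (B : EReal))
    {x : ι → EReal} (y : ι → EReal) (hx : Tendsto x lf (𝓝 (z : EReal))) {η : ℝ} (hη : 0 < η) :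
    ∀ᶠ i in lf, elog (c i) (muIccE (μ i) (x i) (y i)) ≤ ((B - t * z + η : ℝ) : EReal) := by
  have hδ : 0 < η / (1 + t) := by positivity
  set δ := η / (1 + t) with hδdef
  have hδη : δ + t * δ = η := by rw [hδdef]; field_simp
  have e1 := hx.eventually_const_lt (u := ((z - δ : ℝ) : EReal))
    (by exact_mod_cast sub_lt_self z hδ)
  have e2 := eventually_lt_of_limsup_lt (hB.trans_lt
    (show (B : EReal) < ((B + δ : ℝ) : EReal) by exact_mod_cast lt_add_of_pos_right B hδ))
  filter_upwards [e1, e2] with i h1 h2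
  rw [elog_le_coe_iff (hc i)]
  have hsub : muIccE (μ i) (x i) (y i) ≤ μ i (Ici (z - δ)) :=
    measure_mono fun w hw => by exact_mod_cast (h1.trans_le hw.1).le
  refine (hsub.trans (measure_Ici_le_exp_mul (μ i) (hc i) ht _)).trans
    ((mul_le_mul_right ((elog_le_coe_iff (hc i) _ _).1 h2.le) _).trans_eq ?_)
  rw [← ENNReal.ofReal_mul (by positivity), ← Real.exp_add, ← add_div]
  congr 3
  linarith

theorem statement5
    {ι : Type*} (lf : Filter ι) [lf.NeBot]
    (μ : ι → Measure ℝ) [∀ i, IsProbabilityMeasure (μ i)]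
    (c : ι → ℝ) (hc : ∀ i, 0 < c i) (hc0 : Filter.Tendsto c lf (nhds (0 : ℝ)))
    (L : ℝ → EReal) (hL : L = genLogMGF lf μ c)
    (lam : ℝ) (hlam : 0 ≤ lam) (eps : ℝ) (heps : 0 < eps)
    (hdiff : ∀ t ∈ Set.Ioo lam (lam + eps), EDifferentiableAt L t)
    (hsup : ∀ t ∈ Set.Ioo lam (lam + eps), ∃ s ∈ Set.Ioo lam (lam + eps),
      rightDerivE L t < rightDerivE L s)
    (hrc : lam = 0 → rightLimE (rightDerivE L) 0 = ⊥ →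
      Filter.Tendsto L (nhdsWithin 0 (Set.Ioi 0)) (nhds (0 : EReal)))
    (z : ℝ) (hz1 : rightLimE (rightDerivE L) lam ≤ (z : EReal)) (hz2 : (z : EReal) < leftLimE (rightDerivE L) (lam + eps))
    (tz : ℝ) (htz : tz ∈ Set.Ico lam (lam + eps))
    (htzz : rightLimE (rightDerivE L) tz = (z : EReal))
    (tseq : ℕ → ℝ) (htgt : ∀ i, tildeOf L tz < tseq i)
    (htlim : Filter.Tendsto tseq Filter.atTop (nhds (tildeOf L tz)))
    (hex : ∀ i, ∃ Li : EReal,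
      Filter.Tendsto (fun a => elog (c a)
        (∫⁻ x : ℝ, ENNReal.ofReal (Real.exp (tseq i * x / c a)) ∂ (μ a))) lf (nhds Li))
    (x y : ι → EReal)
    (hx : Filter.Tendsto x lf (nhds ((z : EReal))))
    (hy : (z : EReal) < Filter.liminf y lf) :
    Filter.Tendsto (fun i => elog (c i) (muIccE (μ i) (x i) (y i))) lf
      (nhds (rightLimE L tz - (tz : EReal) * (z : EReal))) ∧
    Filter.Tendsto (fun i => elog (c i) (muIooE (μ i) (x i) (y i))) lf
      (nhds (rightLimE L tz - (tz : EReal) * (z : EReal))) := by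
  have hconv : EConvex L := fun s t a b A B ha hb hab hs ht => by
    rw [hL] at hs ht ⊢
    exact genLogMGF_convex lf μ c hc ha hb hab hs ht
  set b := lam + eps with hb
  have hfin : ∀ t ∈ Ioo lam b, ∃ r : ℝ, L t = (r : EReal) := fun t ht => (hdiff t ht).1
  have hbot := hconv.ne_bot (lt_add_of_pos_right lam heps) hfin
  have hev : ∀ t ∈ Ioo lam b, ∀ᶠ s in 𝓝 t, ∃ r : ℝ, L s = (r : EReal) := fun t ht =>
    Filter.mem_of_superset (isOpen_Ioo.mem_nhds ht) hfin
  set g : ℝ → ℝ := fun t => (L t).toReal with hg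
  have hsub : Ioo tz b ⊆ Ioo lam b := Ioo_subset_Ioo_left htz.1
  have hLg : ∀ t ∈ Ioo lam b, L t = (g t : EReal) := fun t ht => by
    obtain ⟨r, hr⟩ := hfin t ht
    simp [hg, hr]
  have hgd : ∀ t ∈ Ioo lam b, DifferentiableAt ℝ g t := fun t ht =>
    (hdiff t ht).differentiableAt_toReal (hev t ht)
  have hD : ∀ t ∈ Ioo lam b, rightDerivE L t = ((deriv g t : ℝ) : EReal) := fun t ht =>
    hconv.rightDerivE_eq hbot (hev t ht) (hgd t ht)
  have hgconv : ConvexOn ℝ (Ioo tz b) g :=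
    (hconv.convexOn_toReal hbot).subset (fun t ht => by simp [hLg t (hsub ht)]) (convex_Ioo _ _)
  obtain ⟨s₀, hzs₀, hs₀⟩ := ((frequently_lt_of_lt_limsup (h := hz2)).and_eventually
    (eventually_mem_set.2 (Ioo_mem_nhdsLT htz.2))).exists
  rw [hD s₀ (hsub hs₀)] at hzs₀
  obtain ⟨m, hlim, hup, htzT, hTb, hright, hslope⟩ := EConvex.tildeOf_spec hgconv
    (fun t ht => hLg t (hsub ht)) (fun t ht => hgd t (hsub ht)) (fun t ht => hD t (hsub ht))
    htzz hs₀ (by exact_mod_cast hzs₀)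
  have hval : rightLimE L tz - (tz : EReal) * (z : EReal) = (m : EReal) := by
    rw [hlim, ← EReal.coe_mul, ← EReal.coe_sub, add_sub_cancel_right]
  have hupper : ∀ η > 0, ∀ᶠ i in lf,
      elog (c i) (muIccE (μ i) (x i) (y i)) ≤ ((m + η : ℝ) : EReal) := fun η hη => by
    obtain ⟨t, ht, hmt⟩ := hup (η / 2) (half_pos hη)
    have ht0 : 0 ≤ t := hlam.trans (hsub ht).1.le
    have hB : genLogMGF lf μ c t ≤ (g t : EReal) := hL ▸ (hLg t (hsub ht)).le
    filter_upwards [eventually_elog_muIccE_le lf μ c hc ht0 hB y hx (half_pos hη)] with i hi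
    refine hi.trans ?_
    exact_mod_cast (by linarith : g t - t * z + η / 2 ≤ m + η)
  have hlower : ∀ η > 0, ∀ᶠ i in lf,
      ((m - η : ℝ) : EReal) ≤ elog (c i) (muIooE (μ i) (x i) (y i)) := fun η hη => by
    obtain ⟨w, hzw, hwy⟩ := EReal.lt_iff_exists_real_btwn.1 hy
    replace hzw : z < w := by exact_mod_cast hzw
    have hb0 : 0 < b := by linarith
    have hρ : 0 < min (w - z) (η / (2 * b)) := lt_min (sub_pos.2 hzw) (by positivity)
    set ρ := min (w - z) (η / (2 * b)) with hρdef
    have hρw : ρ ≤ w - z := min_le_left _ _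
    have hρη : b * ρ ≤ η / 2 :=
      (mul_le_mul_of_nonneg_left (min_le_right _ _) hb0.le).trans_eq (by field_simp)
    have hseq : Tendsto tseq atTop (𝓝[>] (tildeOf L tz)) :=
      tendsto_nhdsWithin_iff.2 ⟨htlim, Eventually.of_forall htgt⟩
    obtain ⟨n, hnb, hnρ⟩ := ((hseq.eventually (eventually_mem_set.2 (Ioo_mem_nhdsGT hTb))).and
      (hseq.eventually (hslope (ρ / 2) (half_pos hρ)))).exists
    obtain ⟨ℓ, hℓ⟩ := hex n
    set t := tseq n with htdef
    have htI : t ∈ Ioo lam b := ⟨(htz.1.trans htzT).trans_lt hnb.1, hnb.2⟩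
    have ht0 : 0 ≤ t := hlam.trans htI.1.le
    obtain ⟨hzv, hmg⟩ := hright t hnb
    have hℓg : ℓ = (g t : EReal) := by
      rw [← hLg t htI, hL]
      exact hℓ.limsup_eq.symm
    rw [hℓg] at hℓ
    set v := deriv g t with hv
    set δ := (v - z) / 2 with hδdef
    have hδ : 0 < δ := by simp only [hδdef]; linarith
    have hgev : ∀ᶠ s in 𝓝 t, genLogMGF lf μ c s ≤ (g s : EReal) := by
      filter_upwards [isOpen_Ioo.mem_nhds htI] with s hs
      exact hL ▸ (hLg s hs).le
    have hmain := eventually_exp_le_measure_Ioo lf μ c hc hc0 g ht0 hδ (half_pos hη) hgev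
      (hgd t htI).hasDerivAt hℓ
    have hxev := hx.eventually_lt_const (u := ((v - δ : ℝ) : EReal))
      (by exact_mod_cast (by simp only [hδdef]; linarith : z < v - δ))
    filter_upwards [hmain, hxev, eventually_lt_of_lt_liminf hwy] with i h1 h2 h3
    have hincl : μ i (Ioo (v - δ) (v + δ)) ≤ muIooE (μ i) (x i) (y i) := by
      refine measure_mono fun u hu => ⟨h2.trans (by exact_mod_cast hu.1), lt_trans ?_ h3⟩
      have : u < w := by
        have := hu.2
        simp only [hδdef] at this
        linarith
      exact_mod_cast this
    refine le_trans ?_ (h1.trans (elog_mono (hc i) hincl))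
    have hvδ : v + δ - z ≤ ρ := by simp only [hδdef]; linarith
    have hprod : t * (v + δ - z) ≤ b * ρ :=
      mul_le_mul htI.2.le hvδ (by linarith) hb0.le
    exact_mod_cast (by linarith : m - η ≤ g t - t * (v + δ) - η / 2)
  rw [hval]
  refine ⟨tendsto_coe_ereal_of_forall_pos (fun η hη => ?_) hupper,
    tendsto_coe_ereal_of_forall_pos hlower fun η hη => ?_⟩
  · filter_upwards [hlower η hη] with i hi
    exact hi.trans (elog_mono (hc i) (muIooE_le_muIccE _ _ _))
  · filter_upwards [hupper η hη] with i hi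
    exact (elog_mono (hc i) (muIooE_le_muIccE _ _ _)).trans hi
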